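/- (Exponential substitution solves the fractional chemotaxis equation with linear reactions.) Let $0<\gamma<1$, $k\in\mathbb R$, $D_\gamma>0$, $\chi_\gamma\in\mathbb R$, and let $c,y:\mathbb R\times[0,\infty)\to\mathbb R$, where $x\mapsto c(x,t)$ is continuously differentiable for each $t\ge 0$. For $g:[0,\infty)\to\mathbb R$ write $D^{1-\gamma}g(t)=\frac{d}{dt}\Big[\frac1{\Gamma(\gamma)}\int_0^t(t-u)^{\gamma-1}g(u)\,du\Big]$; we say that $D^{1-\gamma}g$ exists on $(0,\infty)$ if $u\mapsto(t-u)^{\gamma-1}g(u)$ is Lebesgue integrable on $(0,t)$ for every $t>0$ and the function of $t$ in brackets is differentiable on $(0,\infty)$. For $w:\mathbb R\times[0,\infty)\to\mathbb R$ put $$F_w(x,t)=D_\gamma\frac{\partial^2 w}{\partial x^2}(x,t)-\chi_\gamma\frac{\partial}{\partial x}\Big(\frac{\partial c}{\partial x}(x,t)\,w(x,t)\Big),$$ and call $w$ regular if for each $t\ge0$ the map $x\mapsto w(x,t)$ is twice continuously differentiable and $x\mapsto\frac{\partial c}{\partial x}(x,t)w(x,t)$ is differentiable, and for each $x$ the map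 $t\mapsto w(x,t)$ is differentiable on $(0,\infty)$. (A) $y$ is a solution of the fractional chemotaxis diffusion equation if $y$ is regular, for each $x$ the derivative $D^{1-\gamma}[F_y(x,\cdot)]$ exists on $(0,\infty)$, and $\frac{\partial y}{\partial t}(x,t)=D^{1-\gamma}[F_y(x,\cdot)](t)$ for all $x\in\mathbb R$, $t>0$. (B) $n$ is a solution of the equation with linear reactions if $n$ is regular, for each $x$ the derivative $D^{1-\gamma}[e^{-k\,\cdot}F_n(x,\cdot)]$ exists on $(0,\infty)$, and $$\frac{\partial n}{\partial t}(x,t)=e^{kt}\,D^{1-\gamma}\big[e^{-k\,\cdot}F_n(x,\cdot)\big](t)+k\,n(x,t)\qquad\text{for all }x\in\mathbb R,\ t>0.$$ Then $n(x,t)=e^{kt}y(x,t)$ is a solution in the sense of (B) if and only if $y$ is a solution in the sense of (A). In particular, if $y$ solves the fractional chemotaxis diffusion equation, then $n=e^{kt}y$ solves the equation with linear reactions. -/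

import Mathlib

noncomputable section

/-- The Riemann–Liouville fractional integral of order `γ`,
`t ↦ (1/Γ(γ)) ∫_0^t (t-u)^{γ-1} g(u) du`. -/
def rlIntegral (γ : ℝ) (g : ℝ → ℝ) (t : ℝ) : ℝ :=
  (1 / Real.Gamma γ) * ∫ u in (0 : ℝ)..t, (t - u) ^ (γ - 1) * g u

/-- The Riemann–Liouville fractional derivative of order `1 - γ`. -/
def rlDeriv (γ : ℝ) (g : ℝ → ℝ) (t : ℝ) : ℝ :=
  deriv (rlIntegral γ g) t

/-- The Riemann–Liouville fractional derivative of order `1 - γ` of `g` exists on `(0,∞)`: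
the integral defining `rlIntegral γ g t` converges for every `t > 0`, and the resulting function
is differentiable at every `t > 0`. -/
structure RLDifferentiable (γ : ℝ) (g : ℝ → ℝ) : Prop where
  integrable : ∀ t : ℝ, 0 < t →
    IntervalIntegrable (fun u => (t - u) ^ (γ - 1) * g u) MeasureTheory.volume 0 t
  differentiableAt : ∀ t : ℝ, 0 < t → DifferentiableAt ℝ (rlIntegral γ g) t

/-- The chemotaxis-diffusion expression `D ∂²y/∂x² - χ ∂/∂x((∂c/∂x) y)` at `(x,t)`;
functions of `(x,t)` are curried, with the space variable first. -/
def chemotaxisDiffusion (D χ : ℝ) (c y : ℝ → ℝ → ℝ) (x t : ℝ) : ℝ :=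
  D * deriv (deriv (fun x' => y x' t)) x
    - χ * deriv (fun x' => deriv (fun x'' => c x'' t) x' * y x' t) x

/-- The regularity that gives the partial derivatives of `y` and of `(∂c/∂x) y` a meaning.
Only times `t ≥ 0` matter. -/
structure ChemotaxisRegular (c y : ℝ → ℝ → ℝ) : Prop where
  space : ∀ t : ℝ, 0 ≤ t → ContDiff ℝ 2 (fun x => y x t)
  flux : ∀ t : ℝ, 0 ≤ t → Differentiable ℝ (fun x => deriv (fun x' => c x' t) x * y x t)
  time : ∀ x t : ℝ, 0 < t → DifferentiableAt ℝ (y x) t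

/-- `y` solves `∂y/∂t = D^{1-γ}[D_γ ∂²y/∂x² - χ_γ ∂/∂x((∂c/∂x) y)]` on `ℝ × (0,∞)`,
all derivatives and integrals involved being required to exist. -/
structure SolvesFracChemotaxis (γ D χ : ℝ) (c y : ℝ → ℝ → ℝ) : Prop where
  regular : ChemotaxisRegular c y
  rlDifferentiable : ∀ x : ℝ, RLDifferentiable γ (fun u => chemotaxisDiffusion D χ c y x u)
  equation : ∀ x t : ℝ, 0 < t →
    deriv (y x) t = rlDeriv γ (fun u => chemotaxisDiffusion D χ c y x u) t

/-- `n` solves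
`∂n/∂t = e^{kt} D^{1-γ}(e^{-kt}[D_γ ∂²n/∂x² - χ_γ ∂/∂x((∂c/∂x) n)]) + k n` on `ℝ × (0,∞)`,
all derivatives and integrals involved being required to exist. -/
structure SolvesFracChemotaxisReaction (γ k D χ : ℝ) (c n : ℝ → ℝ → ℝ) : Prop where
  regular : ChemotaxisRegular c n
  rlDifferentiable : ∀ x : ℝ, RLDifferentiable γ
    (fun u => Real.exp (-(k * u)) * chemotaxisDiffusion D χ c n x u)
  equation : ∀ x t : ℝ, 0 < t →
    deriv (n x) t =
      Real.exp (k * t) *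
          rlDeriv γ (fun u => Real.exp (-(k * u)) * chemotaxisDiffusion D χ c n x u) t
        + k * n x t

end

theorem chemotaxisDiffusion_mul_time (D χ : ℝ) (c y : ℝ → ℝ → ℝ) (a : ℝ → ℝ) (x t : ℝ) :
    chemotaxisDiffusion D χ c (fun x t => a t * y x t) x t =
      a t * chemotaxisDiffusion D χ c y x t := by
  have h1 : deriv (fun x' => a t * y x' t) = fun x' => a t * deriv (fun x' => y x' t) x' := by
    funext x'
    exact deriv_const_mul_field _
  have h2 : (fun x' => deriv (fun x'' => c x'' t) x' * (a t * y x' t)) =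
      fun x' => a t * (deriv (fun x'' => c x'' t) x' * y x' t) := by
    funext x'
    ring
  simp only [chemotaxisDiffusion]
  rw [h1, h2, deriv_const_mul_field, deriv_const_mul_field]
  ring

theorem exp_neg_mul_chemotaxisDiffusion_exp_mul (k D χ : ℝ) (c y : ℝ → ℝ → ℝ) (x t : ℝ) :
    Real.exp (-(k * t)) *
        chemotaxisDiffusion D χ c (fun x t => Real.exp (k * t) * y x t) x t =
      chemotaxisDiffusion D χ c y x t := by
  rw [chemotaxisDiffusion_mul_time D χ c y (fun t => Real.exp (k * t)), ← mul_assoc,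
    ← Real.exp_add, neg_add_cancel, Real.exp_zero, one_mul]

theorem ChemotaxisRegular.mul_time {c y : ℝ → ℝ → ℝ} (h : ChemotaxisRegular c y) {a : ℝ → ℝ}
    (ha : Differentiable ℝ a) : ChemotaxisRegular c (fun x t => a t * y x t) where
  space t ht := contDiff_const.mul (h.space t ht)
  flux t ht := by
    have := (h.flux t ht).const_mul (a t)
    simpa only [mul_left_comm (a t)] using this
  time x t ht := (ha t).mul (h.time x t ht)

theorem chemotaxisRegular_exp_mul_iff (k : ℝ) (c y : ℝ → ℝ → ℝ) :
    ChemotaxisRegular c (fun x t => Real.exp (k * t) * y x t) ↔ ChemotaxisRegular c y := by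
  refine ⟨fun h => ?_, fun h => h.mul_time (a := fun t => Real.exp (k * t)) (by fun_prop)⟩
  have h' := h.mul_time (a := fun t => Real.exp (-(k * t))) (by fun_prop)
  simpa only [← mul_assoc, ← Real.exp_add, neg_add_cancel, Real.exp_zero, one_mul] using h'

theorem deriv_exp_mul_mul (k : ℝ) {f : ℝ → ℝ} {t : ℝ} (hf : DifferentiableAt ℝ f t) :
    deriv (fun s => Real.exp (k * s) * f s) t =
      Real.exp (k * t) * deriv f t + k * (Real.exp (k * t) * f t) := by
  have he : HasDerivAt (fun s => Real.exp (k * s)) (Real.exp (k * t) * k) t := by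
    simpa using ((hasDerivAt_id t).const_mul k).exp
  have h := (he.mul hf.hasDerivAt).deriv
  refine h.trans ?_
  ring

theorem exp_substitution_fractional_chemotaxis_reaction
    (γ k D χ : ℝ) (hγ0 : 0 < γ) (hγ1 : γ < 1) (hD : 0 < D)
    (c y : ℝ → ℝ → ℝ)
    (hc : ∀ t : ℝ, 0 ≤ t → ContDiff ℝ 1 (fun x => c x t)) :
    SolvesFracChemotaxis γ D χ c y ↔
      SolvesFracChemotaxisReaction γ k D χ c (fun x t => Real.exp (k * t) * y x t) := by
  have hF (x : ℝ) : (fun u => Real.exp (-(k * u)) *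
      chemotaxisDiffusion D χ c (fun x t => Real.exp (k * t) * y x t) x u) =
      fun u => chemotaxisDiffusion D χ c y x u :=
    funext fun u => exp_neg_mul_chemotaxisDiffusion_exp_mul k D χ c y x u
  constructor
  · rintro ⟨hreg, hrl, heq⟩
    refine ⟨(chemotaxisRegular_exp_mul_iff k c y).2 hreg, fun x => ?_, fun x t ht => ?_⟩
    · rw [hF]
      exact hrl x
    · rw [hF, ← heq x t ht]
      exact deriv_exp_mul_mul k (hreg.time x t ht)
  · rintro ⟨hreg, hrl, heq⟩
    have hreg' := (chemotaxisRegular_exp_mul_iff k c y).1 hreg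
    refine ⟨hreg', fun x => ?_, fun x t ht => ?_⟩
    · rw [← hF]
      exact hrl x
    · have h := heq x t ht
      rw [hF, deriv_exp_mul_mul k (hreg'.time x t ht)] at h
      exact mul_left_cancel₀ (Real.exp_ne_zero _) (add_right_cancel h)
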